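/- arXiv:1512.03160 — 4 statements merged into one kernel-verified Lean document; each statement's English description precedes it below -/
import Mathlib

section
/- det A ≠ 0 if and only if S_{2ℓ}(−2χ_{−1}, −2χ_{−2}, …, −2χ_{−2ℓ}) ≠ 0. -/
/-!
Common setup (following Adamović–Jing–Misra, "On principal realization of modules for
the affine Lie algebra A₁⁽¹⁾ at the critical level").

Half-integers `(1/2)ℤ` are encoded by doubling: an integer `n : ℤ` stands for the
half-integer `n/2`.
-/

noncomputable section

/-- Positive half-integers (doubled encoding): `n : ℤ` with `0 < n` stands for `n/2`. -/
abbrev HalfPos : Type := {n : ℤ // 0 < n}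

/-- The fermionic space `F = ⋀ V`, where `V` has basis `{e_r : r ∈ (1/2)ℤ, r > 0}`;
`F` is presented through its monomial basis, indexed by finite sets of positive
half-integers. -/
abbrev FSpace : Type := Finset HalfPos →₀ ℂ

/-- The basis monomial `e_{r₁} ∧ ⋯ ∧ e_{r_k}` (`r₁ < ⋯ < r_k` being the elements of `s`). -/
def bVec (s : Finset HalfPos) : FSpace := Finsupp.single s 1

/-- The vacuum vector `𝟙`. -/
def vacuum : FSpace := bVec ∅

/-- The vector `e_r`. -/
def eVec (r : HalfPos) : FSpace := bVec {r}

/-- `Φ(-r)` for `r > 0`: left exterior multiplication by `e_r`. -/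
def phiCreate (r : HalfPos) : FSpace →ₗ[ℂ] FSpace :=
  Finsupp.linearCombination ℂ fun s : Finset HalfPos =>
    if r ∈ s then 0
    else ((-1 : ℂ) ^ (s.filter fun t => t < r).card) • bVec (insert r s)

/-- `Φ(r)` for `r > 0`: the odd derivation of `⋀ V` with `Φ(r) e_s = -(-1)^{2r} δ_{r,s} 𝟙`
(`(-1)^{2r} = (-1)^m` for the doubled index `m = 2r`). -/
def phiAnnih (r : HalfPos) : FSpace →ₗ[ℂ] FSpace :=
  Finsupp.linearCombination ℂ fun s : Finset HalfPos =>
    if r ∈ s then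
      ((-(-1 : ℂ) ^ r.1) * (-1 : ℂ) ^ (s.filter fun t => t < r).card) • bVec (s.erase r)
    else 0

/-- `Φ(m)`, `m ∈ (1/2)ℤ` (doubled index `m : ℤ`); `Φ(0) = ε c · Id`. -/
def Phi (ε c : ℂ) (m : ℤ) : FSpace →ₗ[ℂ] FSpace :=
  if h : 0 < m then phiAnnih ⟨m, h⟩
  else if h' : m < 0 then phiCreate ⟨-m, by omega⟩
  else (ε * c) • LinearMap.id

/-- `G(m) = (-m - 1/2) Φ(m) + Σ_{j ≤ p} χ_j Φ(m-j)` (a locally finite sum): on a basis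
monomial `bVec s` only the finitely many indices `j` belonging to
`Finset.Icc m p ∪ (s.image fun t => m - t.1).filter (· ≤ p)` contribute (for any other
`j ≤ p` one has `Φ(m-j) (bVec s) = 0`), and the operator is defined by its values on
this basis.  (All indices are doubled: `m` stands for `m/2`, and `χ j` for `χ_{j/2}`.) -/
def Gop (ε c : ℂ) (p : ℤ) (χ : ℤ → ℂ) (m : ℤ) : FSpace →ₗ[ℂ] FSpace :=
  Finsupp.linearCombination ℂ fun s : Finset HalfPos =>
    (-((m : ℂ) + 1) / 2) • Phi ε c m (bVec s) +
      ∑ j ∈ Finset.Icc m p ∪ (s.image fun t => m - t.1).filter (· ≤ p),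
        χ j • Phi ε c (m - j) (bVec s)

/-- A subspace `W ⊆ F` is `G`-invariant if `G(m) W ⊆ W` for all `m ∈ (1/2)ℤ`. -/
def GInvariant (ε c : ℂ) (p : ℤ) (χ : ℤ → ℂ) (W : Submodule ℂ FSpace) : Prop :=
  ∀ m : ℤ, ∀ v ∈ W, Gop ε c p χ m v ∈ W

/-- `F(χ)` is irreducible: its only `G`-invariant subspaces are `{0}` and `F`. -/
def FIrreducible (ε c : ℂ) (p : ℤ) (χ : ℤ → ℂ) : Prop :=
  ∀ W : Submodule ℂ FSpace, GInvariant ε c p χ W → W = ⊥ ∨ W = ⊤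

/-- `S(-k)` for an integer `k ≥ 1`: the coefficients of
`½(χ⁽¹⁾(z)² + ∂_z χ⁽¹⁾(z)) = Σ_n S(n) z^{-n-2}`, i.e.
`S(-k) = ½(Σ_{a+b=k, a,b ≥ 0} χ_{-a} χ_{-b} + (k-1) χ_{-k})`.
(In the doubled encoding the integer-indexed coefficient `χ_{-a}` is `χ (-(2a))`.) -/
def Sneg (χ : ℤ → ℂ) (k : ℕ) : ℂ :=
  (1 / 2) * ((∑ a ∈ Finset.range (k + 1), χ (-(2 * (a : ℤ))) * χ (-(2 * ((k : ℤ) - (a : ℤ)))))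
    + ((k : ℂ) - 1) * χ (-(2 * (k : ℤ))))

/-- The `2ℓ × 2ℓ` matrix `A(χ)`, where `L = 2ℓ` (0-based indices; the paper's 1-based
entry `A_{ij} = 2 S(-(j-i+1))` for `j ≥ i`, `A_{i,i-1} = ℓ² - (ℓ-i+1)²`, `0` otherwise). -/
def Amat (χ : ℤ → ℂ) (L : ℕ) : Matrix (Fin L) (Fin L) ℂ :=
  Matrix.of fun i j : Fin L =>
    if (i : ℕ) ≤ (j : ℕ) then 2 * Sneg χ ((j : ℕ) - (i : ℕ) + 1)
    else if (j : ℕ) + 1 = (i : ℕ) then ((L : ℂ) / 2) ^ 2 - ((L : ℂ) / 2 - (i : ℕ)) ^ 2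
    else 0

/-- The Schur polynomials `S_m(x₁, …, x_m)`, defined by the generating function
`exp(Σ_{k ≥ 1} (x_k/k) zᵏ) = Σ_{m ≥ 0} S_m(x₁,…,x_m) zᵐ`; equivalently, by the
recursion `S_0 = 1`, `m·S_m = Σ_{k=1}^m x_k S_{m-k}`. -/
def schurS (x : ℕ → ℂ) : ℕ → ℂ
  | 0 => 1
  | m + 1 => (1 / ((m : ℂ) + 1)) *
      ∑ j ∈ (Finset.range (m + 1)).attach, x (m + 1 - (j : ℕ)) * schurS x (j : ℕ)
  decreasing_by exact Finset.mem_range.mp j.2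

open PowerSeries in
/-- The Euler operator `z d/dz` acts diagonally on coefficients. -/
theorem coeff_X_mul_derivative (f : ℂ⟦X⟧) (n : ℕ) :
    coeff n (X * d⁄dX ℂ f) = n * coeff n f := by
  cases n with
  | zero => simp
  | succ n => rw [coeff_succ_X_mul, coeff_derivative]; push_cast; ring

/-- The recursion defining the Schur polynomials. -/
theorem succ_mul_schurS (x : ℕ → ℂ) (m : ℕ) :
    ((m : ℂ) + 1) * schurS x (m + 1) =
      ∑ j ∈ Finset.range (m + 1), x (m + 1 - j) * schurS x j := by
  rw [schurS, Finset.sum_attach (Finset.range (m + 1)) fun j => x (m + 1 - j) * schurS x j]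
  have : (m : ℂ) + 1 ≠ 0 := by exact_mod_cast m.succ_ne_zero
  field_simp

open PowerSeries in
/-- The power series without constant term whose `k`-th coefficient is `x k` for `k ≥ 1`. -/
def positivePart (x : ℕ → ℂ) : ℂ⟦X⟧ := PowerSeries.mk fun k => if k = 0 then 0 else x k

open PowerSeries in
/-- The generating function of the Schur polynomials solves `z f' = (∑ x_k z^k) f`. -/
theorem X_mul_derivative_mk_schurS (x : ℕ → ℂ) :
    X * d⁄dX ℂ (PowerSeries.mk (schurS x)) = positivePart x * PowerSeries.mk (schurS x) := by
  ext n
  rw [coeff_X_mul_derivative, mul_comm (positivePart x), coeff_mul,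
    Finset.Nat.sum_antidiagonal_eq_sum_range_succ
      fun i j => coeff i (PowerSeries.mk (schurS x)) * coeff j (positivePart x)]
  cases n with
  | zero => simp [positivePart]
  | succ n =>
    rw [Finset.sum_range_succ]
    simp only [positivePart, coeff_mk, Nat.sub_self, if_true, mul_zero, add_zero]
    push_cast
    rw [succ_mul_schurS]
    refine Finset.sum_congr rfl fun j hj => ?_
    have := Finset.mem_range.mp hj
    rw [if_neg (by omega), mul_comm]

open PowerSeries in
/-- The potential `L x + x² + z x'` attached to a power series `x`. -/
def potential (L : ℕ) (x : ℂ⟦X⟧) : ℂ⟦X⟧ := (L : ℂ⟦X⟧) * x + x ^ 2 + X * d⁄dX ℂ x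

open PowerSeries in
theorem coeff_potential (L : ℕ) (χ : ℤ → ℂ) (hχ0 : χ 0 = ((L : ℂ) + 1) / 2) (k : ℕ) :
    coeff (k + 1) (potential L (positivePart fun n => χ (-(2 * (n : ℤ))))) =
      2 * Sneg χ (k + 1) := by
  set x := positivePart fun n => χ (-(2 * (n : ℤ))) with hx
  have hY : PowerSeries.mk (fun n : ℕ => χ (-(2 * (n : ℤ)))) = x + C (χ 0) := by
    ext n
    cases n <;> simp [hx, positivePart]
  have hxk : coeff (k + 1) x = χ (-(2 * ((k + 1 : ℕ) : ℤ))) := by simp [hx, positivePart]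
  have hsum : ∑ a ∈ Finset.range (k + 1 + 1),
      χ (-(2 * (a : ℤ))) * χ (-(2 * (((k + 1 : ℕ) : ℤ) - (a : ℤ)))) =
      coeff (k + 1) ((x + C (χ 0)) * (x + C (χ 0))) := by
    rw [← hY, coeff_mul, Finset.Nat.sum_antidiagonal_eq_sum_range_succ
      fun i j => coeff i (PowerSeries.mk fun n : ℕ => χ (-(2 * (n : ℤ)))) *
        coeff j (PowerSeries.mk fun n : ℕ => χ (-(2 * (n : ℤ))))]
    refine Finset.sum_congr rfl fun a ha => ?_
    have := Finset.mem_range.mp ha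
    rw [coeff_mk, coeff_mk, Nat.cast_sub (by omega)]
  have hsq : (x + C (χ 0)) * (x + C (χ 0)) = x ^ 2 + C (2 * χ 0) * x + C (χ 0 * χ 0) := by
    simp only [map_mul, map_ofNat]; ring
  have hL : (L : ℂ⟦X⟧) = C (L : ℂ) := by simp
  rw [Sneg, hsum, hsq, potential, hL]
  simp only [map_add, coeff_C_mul, coeff_X_mul_derivative, coeff_C, hxk, hχ0]
  rw [if_neg k.succ_ne_zero]
  push_cast
  ring

open PowerSeries in
/-- If `z P' = x P`, `z Q' = -2 x Q` and `z W' - L W = Q - s z^L`, then `P W` solves the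
second order equation with potential `L x + x² + z x'` up to an explicit error term. -/
theorem euler_operator_mul_eq (L : ℕ) (x P Q W : ℂ⟦X⟧) (s : ℂ)
    (hP : X * d⁄dX ℂ P = x * P) (hQ : X * d⁄dX ℂ Q = -2 * x * Q)
    (hW : X * d⁄dX ℂ W = (L : ℂ⟦X⟧) * W + Q - C s * X ^ L) :
    X * d⁄dX ℂ (X * d⁄dX ℂ (P * W)) - (L : ℂ⟦X⟧) * (X * d⁄dX ℂ (P * W)) -
      potential L x * (P * W) = -(C s * X ^ L * P * ((L : ℂ⟦X⟧) + 2 * x)) := by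
  have hD : ∀ f g : ℂ⟦X⟧, X * d⁄dX ℂ (f * g) = X * d⁄dX ℂ f * g + f * (X * d⁄dX ℂ g) := by
    intro f g
    rw [Derivation.leibniz, smul_eq_mul, smul_eq_mul]; ring
  have hC : X * d⁄dX ℂ (C s * X ^ L) = (L : ℂ⟦X⟧) * (C s * X ^ L) := by
    ext n
    have hL : (L : ℂ⟦X⟧) = C (L : ℂ) := by simp
    rw [coeff_X_mul_derivative, hL]
    simp only [coeff_C_mul, coeff_X_pow]
    split_ifs with h
    · rw [h]
    · simp
  have hLW : X * d⁄dX ℂ ((L : ℂ⟦X⟧) * W) = (L : ℂ⟦X⟧) * (X * d⁄dX ℂ W) := by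
    rw [hD]; simp
  have h1 : X * d⁄dX ℂ (P * W) = P * (x * W + ((L : ℂ⟦X⟧) * W + Q - C s * X ^ L)) := by
    rw [hD, hP, hW]; ring
  have h2 : X * d⁄dX ℂ (x * W + ((L : ℂ⟦X⟧) * W + Q - C s * X ^ L)) =
      X * d⁄dX ℂ x * W + x * (X * d⁄dX ℂ W) + ((L : ℂ⟦X⟧) * (X * d⁄dX ℂ W) +
        X * d⁄dX ℂ Q - X * d⁄dX ℂ (C s * X ^ L)) := by
    rw [← hLW, ← hD]; simp only [map_add, map_sub]; ring
  rw [h1, hD, h2, hP, hC, hQ, hW, potential]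
  ring

/-- Row vectors multiplied by `Amat` are given by a convolution and a shift. -/
theorem vecMul_Amat (χ : ℤ → ℂ) (L : ℕ) (b : ℕ → ℂ) (j : Fin L) :
    Matrix.vecMul (fun i : Fin L => b i) (Amat χ L) j =
      ∑ i ∈ Finset.range (j + 1), b i * (2 * Sneg χ (j - i + 1)) +
        ((j : ℂ) + 1) * (L - ((j : ℂ) + 1)) * b (j + 1) := by
  obtain ⟨j, hj⟩ := j
  simp only [Matrix.vecMul, dotProduct, Amat, Matrix.of_apply]
  rw [Fin.sum_univ_eq_sum_range (fun i => b i * (if i ≤ j then 2 * Sneg χ (j - i + 1)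
    else if j + 1 = i then ((L : ℂ) / 2) ^ 2 - ((L : ℂ) / 2 - i) ^ 2 else 0)) L]
  have hext : ∑ i ∈ Finset.range L, b i * (if i ≤ j then 2 * Sneg χ (j - i + 1)
      else if j + 1 = i then ((L : ℂ) / 2) ^ 2 - ((L : ℂ) / 2 - i) ^ 2 else 0) =
      ∑ i ∈ Finset.range (L + 1), b i * (if i ≤ j then 2 * Sneg χ (j - i + 1)
      else if j + 1 = i then ((L : ℂ) / 2) ^ 2 - ((L : ℂ) / 2 - i) ^ 2 else 0) := by
    rw [Finset.sum_range_succ, if_neg (by omega)]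
    have : ((L : ℂ) / 2) ^ 2 - ((L : ℂ) / 2 - L) ^ 2 = 0 := by ring
    simp [this]
  rw [hext, ← Finset.sum_subset (Finset.range_mono (show j + 1 + 1 ≤ L + 1 by omega)),
    Finset.sum_range_succ, if_neg (by omega), if_pos rfl]
  · congr 1
    · refine Finset.sum_congr rfl fun i hi => ?_
      have := Finset.mem_range.mp hi
      rw [if_pos (by omega)]
    · push_cast; ring
  · intro i _ hi
    rw [Finset.mem_range] at hi
    rw [if_neg (by omega), if_neg (by omega), mul_zero]

open PowerSeries in
/-- There is a sequence `b` with `b 0 ≠ 0` that `Amat` maps to a multiple of the last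
coordinate vector, the factor being `L` times the Schur polynomial. -/
theorem exists_vecMul_Amat_eq (L : ℕ) (hL : 0 < L) (χ : ℤ → ℂ)
    (hχ0 : χ 0 = ((L : ℂ) + 1) / 2) :
    ∃ b : ℕ → ℂ, b 0 ≠ 0 ∧ ∀ j : Fin L,
      Matrix.vecMul (fun i : Fin L => b i) (Amat χ L) j =
        if (j : ℕ) + 1 = L then L * schurS (fun k => -2 * χ (-(2 * (k : ℤ)))) L else 0 := by
  set s := schurS (fun k => -2 * χ (-(2 * (k : ℤ)))) with hs
  set x := positivePart fun n => χ (-(2 * (n : ℤ))) with hx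
  set P : ℂ⟦X⟧ := PowerSeries.mk (schurS fun n => χ (-(2 * (n : ℤ)))) with hPdef
  set W : ℂ⟦X⟧ := PowerSeries.mk fun n => if n = L then 0 else s n / ((n : ℂ) - L) with hWdef
  have hLC : (L : ℂ⟦X⟧) = C (L : ℂ) := by simp
  have hP : X * d⁄dX ℂ P = x * P := X_mul_derivative_mk_schurS _
  have hQ : X * d⁄dX ℂ (PowerSeries.mk s) = -2 * x * PowerSeries.mk s := by
    rw [hs, X_mul_derivative_mk_schurS]
    congr 1
    have h2 : (-2 : ℂ⟦X⟧) = C (-2 : ℂ) := by rw [map_neg, map_ofNat]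
    ext n
    rw [h2, coeff_C_mul]
    simp [hx, positivePart]
  have hW : X * d⁄dX ℂ W = (L : ℂ⟦X⟧) * W + PowerSeries.mk s - C (s L) * X ^ L := by
    ext n
    simp only [coeff_X_mul_derivative, hLC, map_sub, map_add, coeff_C_mul, coeff_X_pow, hWdef,
      coeff_mk]
    split_ifs with h
    · simp [h]
    · have : (n : ℂ) - L ≠ 0 := sub_ne_zero.mpr (by exact_mod_cast h)
      field_simp
      ring
  have key := euler_operator_mul_eq L x P (PowerSeries.mk s) W (s L) hP hQ hW
  refine ⟨fun n => coeff n (P * W), ?_, fun j => ?_⟩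
  · have : (L : ℂ) ≠ 0 := by exact_mod_cast hL.ne'
    simp [coeff_zero_eq_constantCoeff_apply, hPdef, hWdef, hL.ne, schurS, hs, this]
  · rw [vecMul_Amat χ L fun n => coeff n (P * W)]
    have hsum : ∑ i ∈ Finset.range ((j : ℕ) + 1),
        coeff i (P * W) * (2 * Sneg χ (j - i + 1)) =
        coeff ((j : ℕ) + 1) (potential L x * (P * W)) := by
      rw [mul_comm (potential L x), coeff_mul (j + 1),
        Finset.Nat.sum_antidiagonal_eq_sum_range_succ
          fun i k => coeff i (P * W) * coeff k (potential L x),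
        Finset.sum_range_succ _ ((j : ℕ) + 1)]
      have h0 : coeff 0 (potential L x) = 0 := by
        simp [potential, hx, positivePart]
      rw [Nat.sub_self, h0, mul_zero, add_zero]
      refine Finset.sum_congr rfl fun i hi => ?_
      have := Finset.mem_range.mp hi
      rw [show (j : ℕ) + 1 - i = j - i + 1 by omega, coeff_potential L χ hχ0]
    have hcoeff := congrArg (coeff ((j : ℕ) + 1)) key
    have herr : C (s L) * X ^ L * P * ((L : ℂ⟦X⟧) + 2 * x) =
        X ^ L * (C (s L) * P * ((L : ℂ⟦X⟧) + 2 * x)) := by ring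
    rw [herr] at hcoeff
    simp only [map_sub, map_neg, hLC, coeff_X_mul_derivative, coeff_C_mul, coeff_X_pow_mul']
      at hcoeff
    rw [hsum]
    have hj := j.2
    split_ifs with h
    · rw [if_pos h.ge, h, Nat.sub_self] at hcoeff
      have hlast : coeff 0 (C (s L) * P * (C (L : ℂ) + 2 * x)) = s L * L := by
        simp [hPdef, hx, positivePart, schurS]
      rw [hlast] at hcoeff
      have hjL : (j : ℂ) + 1 = L := by exact_mod_cast h
      rw [h, hjL]
      linear_combination -hcoeff
    · rw [if_neg (by omega)] at hcoeff
      push_cast at hcoeff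
      linear_combination -hcoeff

/-- A left vector with vanishing first coordinate that `Amat` maps to a multiple of the last
coordinate vector is zero. -/
theorem eq_zero_of_vecMul_Amat_eq_zero (χ : ℤ → ℂ) (L : ℕ) (b : ℕ → ℂ) (h0 : b 0 = 0)
    (hb : ∀ j : Fin L, (j : ℕ) + 1 ≠ L →
      Matrix.vecMul (fun i : Fin L => b i) (Amat χ L) j = 0) (n : ℕ) (hn : n < L) :
    b n = 0 := by
  induction n using Nat.strong_induction_on with
  | _ n ih =>
    cases n with
    | zero => exact h0
    | succ n =>
      have h := hb ⟨n, by omega⟩ (by simp only; omega)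
      rw [vecMul_Amat, Finset.sum_eq_zero, zero_add] at h
      · have h1 : (n : ℂ) + 1 ≠ 0 := by exact_mod_cast n.succ_ne_zero
        have h2 : (L : ℂ) - ((n : ℂ) + 1) ≠ 0 := sub_ne_zero.mpr (by exact_mod_cast hn.ne')
        exact (mul_eq_zero.mp h).resolve_left (mul_ne_zero h1 h2)
      · intro i hi
        have := Finset.mem_range.mp hi
        simp only at this
        rw [ih i (by omega) (by omega), zero_mul]

/-- Lemma 5.7 of the paper.  `det A ≠ 0` iff
`S_{2ℓ}(-2χ₋₁, …, -2χ_{-2ℓ}) ≠ 0` (`L = 2ℓ`; `χ₋ₖ = χ (-(2k))` doubled). -/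
theorem detA_ne_zero_iff_schur
    (L : ℕ) (hL : 0 < L) (χ : ℤ → ℂ) (hχ0 : χ 0 = ((L : ℂ) + 1) / 2) :
    (Amat χ L).det ≠ 0 ↔ schurS (fun k => -2 * χ (-(2 * (k : ℤ)))) L ≠ 0 := by
  obtain ⟨b, hb0, hb⟩ := exists_vecMul_Amat_eq L hL χ hχ0
  have hLC : (L : ℂ) ≠ 0 := by exact_mod_cast hL.ne'
  rw [not_iff_not, ← Matrix.exists_vecMul_eq_zero_iff]
  constructor
  · rintro ⟨w, hw, hwA⟩
    by_contra hS
    set w' : ℕ → ℂ := fun n => if h : n < L then w ⟨n, h⟩ else 0 with hw'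
    set c : ℂ := w' 0 / b 0 with hc
    have hwfun : (fun i : Fin L => w' i) = w := by
      ext i
      simp [hw']
    have hdiff : (fun i : Fin L => w' i - c * b i) = w - c • fun i : Fin L => b i := by
      rw [← hwfun]; rfl
    have hzero := eq_zero_of_vecMul_Amat_eq_zero χ L (fun n => w' n - c * b n)
      (by simp [hc, hb0]) (fun j hj => by
        rw [hdiff, Matrix.sub_vecMul, Matrix.smul_vecMul, hwA]
        simp [hb, hj])
    have hwc : w = c • fun i : Fin L => b i := by
      ext i
      have := hzero i i.2
      rw [← hwfun]
      exact sub_eq_zero.mp this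
    have hlast := congrFun hwA ⟨L - 1, by omega⟩
    rw [hwc, Matrix.smul_vecMul, Pi.smul_apply, hb, if_pos (by simp only; omega),
      smul_eq_mul, Pi.zero_apply] at hlast
    have hc0 : c = 0 := (mul_eq_zero.mp hlast).resolve_right (mul_ne_zero hLC hS)
    exact hw (by rw [hwc, hc0, zero_smul])
  · intro hS
    refine ⟨fun i => b i, fun h => hb0 (congrFun h ⟨0, hL⟩), ?_⟩
    ext j
    rw [hb, hS]
    simp
end
end

section
/- Assume p = 0, χ₀ ∈ (1/2)ℤ with χ₀ ≤ 0, and the coefficients χ_j for j < 0 are arbitrary. Then the vector e_{1/2−χ₀} = Φ(χ₀−1/2)𝟙 does not belong to the smallest G-invariant subspace of F containing 𝟙; in particular F(χ) is reducible (it has a nonzero proper G-invariant subspace). -/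
/-!
Common setup (following Adamović–Jing–Misra, "On principal realization of modules for
the affine Lie algebra A₁⁽¹⁾ at the critical level").

Half-integers `(1/2)ℤ` are encoded by doubling: an integer `n : ℤ` stands for the
half-integer `n/2`.
-/

noncomputable section

/-- The smallest `G`-invariant subspace of `F` containing a vector `v`. -/
def genSub (ε c : ℂ) (p : ℤ) (χ : ℤ → ℂ) (v : FSpace) : Submodule ℂ FSpace :=
  sInf {W : Submodule ℂ FSpace | GInvariant ε c p χ W ∧ v ∈ W}

/-- The infinite sum `Σ_{r > 0} a_r Φ(r)` of annihilation operators. -/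
def annihField (a : HalfPos → ℂ) : FSpace →ₗ[ℂ] FSpace :=
  Finsupp.linearCombination ℂ fun s : Finset HalfPos => ∑ r ∈ s, a r • phiAnnih r (bVec s)

/-- The sign `(-1)^{#{t ∈ s : t < r}}`. -/
def koszulSign (r : HalfPos) (s : Finset HalfPos) : ℂ :=
  (-1 : ℂ) ^ (s.filter fun t => t < r).card

lemma koszulSign_insert {r q : HalfPos} {s : Finset HalfPos} (hq : q ∉ s) :
    koszulSign r (insert q s) = (if q < r then -1 else 1) * koszulSign r s := by
  unfold koszulSign
  rw [Finset.filter_insert]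
  split_ifs
  · rw [Finset.card_insert_of_notMem (by simp [hq]), pow_succ]; ring
  · simp

lemma koszulSign_erase {r q : HalfPos} {s : Finset HalfPos} (hq : q ∈ s) :
    koszulSign r (s.erase q) = (if q < r then -1 else 1) * koszulSign r s := by
  have h := koszulSign_insert (r := r) (Finset.notMem_erase q s)
  rw [Finset.insert_erase hq] at h
  rw [h]
  split_ifs <;> ring

lemma koszulSign_mul_self (r : HalfPos) (s : Finset HalfPos) :
    koszulSign r s * koszulSign r s = 1 := by
  unfold koszulSign
  rw [← mul_pow]; simp

lemma phiCreate_bVec_of_mem {r : HalfPos} {s : Finset HalfPos} (h : r ∈ s) :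
    phiCreate r (bVec s) = 0 := by
  simp [phiCreate, bVec, h]

lemma phiCreate_bVec_of_notMem {r : HalfPos} {s : Finset HalfPos} (h : r ∉ s) :
    phiCreate r (bVec s) = koszulSign r s • bVec (insert r s) := by
  simp [phiCreate, bVec, h, koszulSign]

lemma phiAnnih_bVec_of_mem {r : HalfPos} {s : Finset HalfPos} (h : r ∈ s) :
    phiAnnih r (bVec s) = (-(-1 : ℂ) ^ r.1 * koszulSign r s) • bVec (s.erase r) := by
  simp [phiAnnih, bVec, h, koszulSign]

lemma phiAnnih_bVec_of_notMem {r : HalfPos} {s : Finset HalfPos} (h : r ∉ s) :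
    phiAnnih r (bVec s) = 0 := by
  simp [phiAnnih, bVec, h]

lemma phiAnnih_anticomm (r q : HalfPos) (s : Finset HalfPos) :
    phiAnnih r (phiAnnih q (bVec s)) = -phiAnnih q (phiAnnih r (bVec s)) := by
  by_cases hrq : r = q
  · subst hrq
    by_cases hr : r ∈ s
    · simp [phiAnnih_bVec_of_mem hr, phiAnnih_bVec_of_notMem]
    · simp [phiAnnih_bVec_of_notMem hr]
  by_cases hr : r ∈ s <;> by_cases hq : q ∈ s
  · rw [phiAnnih_bVec_of_mem hr, phiAnnih_bVec_of_mem hq, map_smul, map_smul,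
      phiAnnih_bVec_of_mem (by simp [hr, hrq]), phiAnnih_bVec_of_mem (by simp [hq, Ne.symm hrq]),
      koszulSign_erase hr, koszulSign_erase hq, Finset.erase_right_comm, smul_smul, smul_smul,
      ← neg_smul]
    congr 1
    rcases lt_or_gt_of_ne hrq with h | h
    · simp [h, h.not_gt]; ring
    · simp [h, h.not_gt]; ring
  · simp [phiAnnih_bVec_of_mem hr, phiAnnih_bVec_of_notMem, hq]
  · simp [phiAnnih_bVec_of_mem hq, phiAnnih_bVec_of_notMem, hr]
  · simp [phiAnnih_bVec_of_notMem, hr, hq]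

lemma phiAnnih_phiCreate (r q : HalfPos) (s : Finset HalfPos) :
    phiAnnih r (phiCreate q (bVec s)) =
      (if r = q then -(-1 : ℂ) ^ r.1 else 0) • bVec s - phiCreate q (phiAnnih r (bVec s)) := by
  by_cases hrq : r = q
  · subst hrq
    by_cases hr : r ∈ s
    · rw [phiCreate_bVec_of_mem hr, phiAnnih_bVec_of_mem hr, map_smul,
        phiCreate_bVec_of_notMem (Finset.notMem_erase r s), koszulSign_erase hr,
        Finset.insert_erase hr, smul_smul, ← sub_smul, map_zero]
      simp [mul_assoc, koszulSign_mul_self]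
    · rw [phiCreate_bVec_of_notMem hr, phiAnnih_bVec_of_notMem hr, map_smul,
        phiAnnih_bVec_of_mem (Finset.mem_insert_self r s), koszulSign_insert hr,
        Finset.erase_insert hr, smul_smul, map_zero, sub_zero]
      simp only [lt_irrefl, if_true, if_false]
      congr 1
      linear_combination (-(-1 : ℂ) ^ r.1) * koszulSign_mul_self r s
  rw [if_neg hrq, zero_smul, zero_sub]
  by_cases hr : r ∈ s <;> by_cases hq : q ∈ s
  · simp [phiAnnih_bVec_of_mem hr, phiCreate_bVec_of_mem, hq, Ne.symm hrq]
  · rw [phiAnnih_bVec_of_mem hr, phiCreate_bVec_of_notMem hq, map_smul, map_smul,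
      phiAnnih_bVec_of_mem (by simp [hr]), phiCreate_bVec_of_notMem (by simp [hq]),
      koszulSign_erase hr, koszulSign_insert hq, smul_smul, smul_smul, ← neg_smul,
      Finset.erase_insert_of_ne (Ne.symm hrq)]
    congr 1
    rcases lt_or_gt_of_ne hrq with h | h
    · simp [h, h.not_gt]; ring
    · simp [h, h.not_gt]; ring
  · simp [phiAnnih_bVec_of_notMem hr, phiCreate_bVec_of_mem hq]
  · simp [phiAnnih_bVec_of_notMem, phiCreate_bVec_of_notMem hq, hr, hrq]

lemma annihField_bVec (a : HalfPos → ℂ) (s : Finset HalfPos) :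
    annihField a (bVec s) = ∑ r ∈ s, a r • phiAnnih r (bVec s) := by
  simp [annihField, bVec]

lemma annihField_bVec_of_subset (a : HalfPos → ℂ) {s T : Finset HalfPos} (h : s ⊆ T) :
    annihField a (bVec s) = ∑ r ∈ T, a r • phiAnnih r (bVec s) := by
  rw [annihField_bVec]
  exact Finset.sum_subset h fun r _ hr => by rw [phiAnnih_bVec_of_notMem hr, smul_zero]

lemma annihField_phiCreate (a : HalfPos → ℂ) (q : HalfPos) (s : Finset HalfPos) :
    annihField a (phiCreate q (bVec s)) =
      (a q * -(-1 : ℂ) ^ q.1) • bVec s - phiCreate q (annihField a (bVec s)) := by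
  have h : annihField a (phiCreate q (bVec s)) =
      ∑ r ∈ insert q s, a r • phiAnnih r (phiCreate q (bVec s)) := by
    by_cases hq : q ∈ s
    · simp [phiCreate_bVec_of_mem hq]
    · rw [phiCreate_bVec_of_notMem hq, map_smul, annihField_bVec, Finset.smul_sum]
      exact Finset.sum_congr rfl fun r _ => by rw [map_smul, smul_comm]
  rw [h, annihField_bVec_of_subset a (Finset.subset_insert q s), map_sum]
  simp only [phiAnnih_phiCreate, smul_sub, Finset.sum_sub_distrib, map_smul]
  congr 1
  rw [Finset.sum_eq_single_of_mem q (Finset.mem_insert_self q s)]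
  · simp [smul_smul]
  · intro r _ hr
    simp [hr]

lemma annihField_phiAnnih (a : HalfPos → ℂ) (q : HalfPos) (s : Finset HalfPos) :
    annihField a (phiAnnih q (bVec s)) = -phiAnnih q (annihField a (bVec s)) := by
  have h : annihField a (phiAnnih q (bVec s)) =
      ∑ r ∈ s, a r • phiAnnih r (phiAnnih q (bVec s)) := by
    by_cases hq : q ∈ s
    · rw [phiAnnih_bVec_of_mem hq, map_smul,
        annihField_bVec_of_subset a (Finset.erase_subset q s), Finset.smul_sum]
      exact Finset.sum_congr rfl fun r _ => by rw [map_smul, smul_comm]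
    · simp [phiAnnih_bVec_of_notMem hq]
  rw [h, annihField_bVec, map_sum, ← Finset.sum_neg_distrib]
  exact Finset.sum_congr rfl fun r _ => by rw [phiAnnih_anticomm, map_smul, smul_neg]

/-- The annihilation field with prescribed anticommutators `β (-r)` with `Φ(-r)`. -/
def dualField (β : ℤ → ℂ) : FSpace →ₗ[ℂ] FSpace :=
  annihField fun r => -(-1 : ℂ) ^ r.1 * β (-r.1)

lemma neg_one_zpow_mul_self (k : ℤ) : (-1 : ℂ) ^ k * (-1 : ℂ) ^ k = 1 := by
  rw [← mul_zpow]; simp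

/-- Since `Φ(0)` is a scalar, moving it past the field flips its sign parameter. -/
lemma dualField_Phi (ε c : ℂ) {β : ℤ → ℂ} (hβ : ∀ k, 0 ≤ k → β k = 0) (k : ℤ)
    (s : Finset HalfPos) :
    dualField β (Phi ε c k (bVec s)) =
      β k • bVec s - Phi (-ε) c k (dualField β (bVec s)) := by
  unfold Phi
  split_ifs with h h'
  · rw [dualField, annihField_phiAnnih, hβ k h.le]; simp
  · rw [dualField, annihField_phiCreate]
    congr 2
    simp only [neg_neg]
    linear_combination β k * neg_one_zpow_mul_self (-k)
  · rw [hβ k (by omega)]; simp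

lemma Phi_bVec_eq_zero (ε c : ℂ) {k : ℤ} (hk : 0 < k) {s : Finset HalfPos}
    (h : ⟨k, hk⟩ ∉ s) : Phi ε c k (bVec s) = 0 := by
  rw [Phi, dif_pos hk, phiAnnih_bVec_of_notMem h]

lemma Gop_bVec (ε c : ℂ) (p : ℤ) (χ : ℤ → ℂ) (m : ℤ) (s : Finset HalfPos) :
    Gop ε c p χ m (bVec s) = (-((m : ℂ) + 1) / 2) • Phi ε c m (bVec s) +
      ∑ j ∈ Finset.Icc m p ∪ (s.image fun t => m - t.1).filter (· ≤ p),
        χ j • Phi ε c (m - j) (bVec s) := by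
  simp [Gop, bVec]

lemma Gop_bVec_of_subset (ε c : ℂ) (p : ℤ) (χ : ℤ → ℂ) (m : ℤ) {s T : Finset HalfPos}
    (h : s ⊆ T) :
    Gop ε c p χ m (bVec s) = (-((m : ℂ) + 1) / 2) • Phi ε c m (bVec s) +
      ∑ j ∈ Finset.Icc m p ∪ (T.image fun t => m - t.1).filter (· ≤ p),
        χ j • Phi ε c (m - j) (bVec s) := by
  rw [Gop_bVec]
  congr 1
  refine Finset.sum_subset (Finset.union_subset_union_right
    (Finset.filter_subset_filter _ (Finset.image_subset_image h))) fun j hj hj' => ?_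
  simp only [Finset.mem_union, Finset.mem_Icc, Finset.mem_filter, Finset.mem_image,
    not_or, not_and] at hj hj'
  have hjp : j ≤ p := by rcases hj with hj | hj <;> exact hj.2
  have hk : 0 < m - j := by
    by_contra hk
    exact hj'.1 (by omega) hjp
  rw [Phi_bVec_eq_zero ε c hk, smul_zero]
  exact fun hs => hj'.2 ⟨_, hs, by simp⟩ hjp

lemma Gop_dualField (ε c : ℂ) (p : ℤ) (χ β : ℤ → ℂ) (m : ℤ) (s : Finset HalfPos) :
    Gop ε c p χ m (dualField β (bVec s)) =
      (-((m : ℂ) + 1) / 2) • Phi ε c m (dualField β (bVec s)) +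
      ∑ j ∈ Finset.Icc m p ∪ (s.image fun t => m - t.1).filter (· ≤ p),
        χ j • Phi ε c (m - j) (dualField β (bVec s)) := by
  let L : FSpace →ₗ[ℂ] FSpace := (-((m : ℂ) + 1) / 2) • Phi ε c m +
    ∑ j ∈ Finset.Icc m p ∪ (s.image fun t => m - t.1).filter (· ≤ p), χ j • Phi ε c (m - j)
  have hL : ∀ x, L x = (-((m : ℂ) + 1) / 2) • Phi ε c m x +
      ∑ j ∈ Finset.Icc m p ∪ (s.image fun t => m - t.1).filter (· ≤ p),
        χ j • Phi ε c (m - j) x := fun x => by simp [L]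
  rw [← hL, dualField, annihField_bVec, map_sum, map_sum]
  refine Finset.sum_congr rfl fun r hr => ?_
  rw [map_smul, map_smul, phiAnnih_bVec_of_mem hr, map_smul, map_smul, hL,
    Gop_bVec_of_subset ε c p χ m (Finset.erase_subset r s)]

lemma dualField_Gop_bVec (ε c : ℂ) (χ : ℤ → ℂ) {β : ℤ → ℂ} (hβ : ∀ k, 0 ≤ k → β k = 0)
    (hrec : ∀ m : ℤ, -((m : ℂ) + 1) / 2 * β m + ∑ j ∈ Finset.Icc m 0, χ j * β (m - j) = 0)
    (m : ℤ) (s : Finset HalfPos) :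
    dualField β (Gop ε c 0 χ m (bVec s)) = -Gop (-ε) c 0 χ m (dualField β (bVec s)) := by
  rw [Gop_dualField, Gop_bVec, map_add, map_smul, map_sum]
  simp only [map_smul, dualField_Phi ε c hβ, smul_sub, Finset.sum_sub_distrib, smul_smul]
  have h : ∑ j ∈ Finset.Icc m 0 ∪ (s.image fun t => m - t.1).filter (· ≤ 0),
      χ j * β (m - j) = ∑ j ∈ Finset.Icc m 0, χ j * β (m - j) := by
    refine (Finset.sum_subset Finset.subset_union_left fun j hj hj' => ?_).symm
    simp only [Finset.mem_union, Finset.mem_Icc, Finset.mem_filter] at hj hj'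
    rw [hβ _ (by omega), mul_zero]
  have h0 := congrArg (fun z : ℂ => z • bVec s) (hrec m)
  simp only [zero_smul, add_smul] at h0
  rw [← Finset.sum_smul, h, eq_neg_iff_add_eq_zero, ← h0]
  module

lemma dualField_Gop (ε c : ℂ) (χ : ℤ → ℂ) {β : ℤ → ℂ} (hβ : ∀ k, 0 ≤ k → β k = 0)
    (hrec : ∀ m : ℤ, -((m : ℂ) + 1) / 2 * β m + ∑ j ∈ Finset.Icc m 0, χ j * β (m - j) = 0)
    (m : ℤ) (v : FSpace) :
    dualField β (Gop ε c 0 χ m v) = -Gop (-ε) c 0 χ m (dualField β v) := by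
  have h : dualField β ∘ₗ Gop ε c 0 χ m = -(Gop (-ε) c 0 χ m ∘ₗ dualField β) :=
    Finsupp.lhom_ext' fun s => LinearMap.ext_ring (dualField_Gop_bVec ε c χ hβ hrec m s)
  exact LinearMap.congr_fun h v

/-- The coefficients, normalized by `1` at `n - 1`, of a field anticommuting with all `G(m)`. -/
def dualCoeff (χ : ℤ → ℂ) (n k : ℤ) : ℂ :=
  if k < n - 1 then
    -(2 / ((n : ℂ) - 1 - k)) *
      ∑ j ∈ (Finset.Ico (k - n + 1) 0).attach, χ j.1 * dualCoeff χ n (k - j.1)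
  else if k = n - 1 then 1 else 0
termination_by (n - 1 - k).toNat
decreasing_by
  have := Finset.mem_Ico.1 j.2
  omega

lemma dualCoeff_of_lt {χ : ℤ → ℂ} {n k : ℤ} (h : k < n - 1) :
    dualCoeff χ n k = -(2 / ((n : ℂ) - 1 - k)) *
      ∑ j ∈ Finset.Ico (k - n + 1) 0, χ j * dualCoeff χ n (k - j) := by
  rw [dualCoeff, if_pos h,
    Finset.sum_attach _ fun j => χ j * dualCoeff χ n (k - j)]

lemma dualCoeff_self (χ : ℤ → ℂ) (n : ℤ) : dualCoeff χ n (n - 1) = 1 := by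
  rw [dualCoeff]; simp

lemma dualCoeff_of_ge {χ : ℤ → ℂ} {n k : ℤ} (h : n ≤ k) : dualCoeff χ n k = 0 := by
  rw [dualCoeff, if_neg (by omega), if_neg (by omega)]

lemma dualCoeff_rec (χ : ℤ → ℂ) (n : ℤ) (hn : n ≤ 0) (hχ0 : χ 0 = (n : ℂ) / 2) (m : ℤ) :
    -((m : ℂ) + 1) / 2 * dualCoeff χ n m +
      ∑ j ∈ Finset.Icc m 0, χ j * dualCoeff χ n (m - j) = 0 := by
  rcases le_or_gt n m with hm | hm
  · rw [dualCoeff_of_ge hm, mul_zero, zero_add]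
    refine Finset.sum_eq_zero fun j hj => ?_
    rw [dualCoeff_of_ge (by have := (Finset.mem_Icc.1 hj).2; omega), mul_zero]
  have hsum : ∑ j ∈ Finset.Icc m 0, χ j * dualCoeff χ n (m - j) =
      χ 0 * dualCoeff χ n m +
        ∑ j ∈ Finset.Ico (m - n + 1) 0, χ j * dualCoeff χ n (m - j) := by
    rw [← Finset.Ico_insert_right (show m ≤ 0 by omega),
      Finset.sum_insert (by simp), sub_zero]
    congr 1
    refine (Finset.sum_subset (Finset.Ico_subset_Ico_left (by omega)) fun j hj hj' => ?_).symm
    rw [Finset.mem_Ico] at hj hj'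
    rw [dualCoeff_of_ge (by omega), mul_zero]
  rw [hsum, hχ0]
  rcases (show m ≤ n - 1 by omega).eq_or_lt with rfl | hlt
  · simp
    ring
  · have hne : (n : ℂ) - 1 - m ≠ 0 := by
      have : n - 1 - m ≠ 0 := by omega
      exact_mod_cast this
    rw [dualCoeff_of_lt hlt]
    field_simp
    ring

lemma GInvariant_ker_dualField (ε c : ℂ) (χ : ℤ → ℂ) {β : ℤ → ℂ}
    (hβ : ∀ k, 0 ≤ k → β k = 0)
    (hrec : ∀ m : ℤ, -((m : ℂ) + 1) / 2 * β m + ∑ j ∈ Finset.Icc m 0, χ j * β (m - j) = 0) :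
    GInvariant ε c 0 χ (LinearMap.ker (dualField β)) := fun m v hv => by
  rw [LinearMap.mem_ker] at hv ⊢
  rw [dualField_Gop ε c χ hβ hrec, hv, map_zero, neg_zero]

lemma vacuum_mem_ker_dualField (β : ℤ → ℂ) : vacuum ∈ LinearMap.ker (dualField β) := by
  rw [LinearMap.mem_ker, vacuum, dualField, annihField_bVec, Finset.sum_empty]

lemma dualField_eVec (β : ℤ → ℂ) (r : HalfPos) : dualField β (eVec r) = β (-r.1) • vacuum := by
  rw [eVec, dualField, annihField_bVec, Finset.sum_singleton,
    phiAnnih_bVec_of_mem (Finset.mem_singleton_self r), smul_smul, Finset.erase_singleton, vacuum]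
  congr 1
  simp only [koszulSign, Finset.filter_singleton, lt_irrefl, if_false, Finset.card_empty, pow_zero]
  linear_combination β (-r.1) * neg_one_zpow_mul_self r.1

lemma vacuum_ne_zero : vacuum ≠ 0 := by
  simp [vacuum, bVec]

/-- Proposition 4.3 of the paper.  If `p = 0` and `χ₀ ∈ ½ℤ`,
`χ₀ ≤ 0` (`χ₀ = n/2`, `n ≤ 0` doubled), then `e_{½-χ₀} = Φ(χ₀-½) 𝟙` does not lie in
the smallest `G`-invariant subspace containing `𝟙`; in particular `F(χ)` has a
nonzero proper `G`-invariant subspace. -/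
theorem Fchi_reducible_of_nonpos
    (ε c : ℂ) (hε : ε = 1 ∨ ε = -1) (hc : c ^ 2 = -(1 / 2))
    (χ : ℤ → ℂ) (n : ℤ) (hn : n ≤ 0) (hχ0 : χ 0 = (n : ℂ) / 2) :
    eVec ⟨1 - n, by omega⟩ ∉ genSub ε c 0 χ vacuum ∧
    ∃ W : Submodule ℂ FSpace, GInvariant ε c 0 χ W ∧ W ≠ ⊥ ∧ W ≠ ⊤ := by
  have hinv : GInvariant ε c 0 χ (LinearMap.ker (dualField (dualCoeff χ n))) :=
    GInvariant_ker_dualField ε c χ (fun k hk => dualCoeff_of_ge (hn.trans hk))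
      (dualCoeff_rec χ n hn hχ0)
  have hvac := vacuum_mem_ker_dualField (dualCoeff χ n)
  have hnot : eVec ⟨1 - n, by omega⟩ ∉ LinearMap.ker (dualField (dualCoeff χ n)) := by
    rw [LinearMap.mem_ker, dualField_eVec, neg_sub, dualCoeff_self, one_smul]
    exact vacuum_ne_zero
  refine ⟨fun h => hnot (Submodule.mem_sInf.1 h _ ⟨hinv, hvac⟩), _, hinv, ?_, ?_⟩
  · exact (Submodule.ne_bot_iff _).2 ⟨_, hvac, vacuum_ne_zero⟩
  · exact fun h => hnot (h ▸ Submodule.mem_top)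
end
end

section
/- Assume p = 0 and χ₀ = ℓ + 1/2 with ℓ ∈ (1/2)ℤ, ℓ ≥ 0 (the coefficients χ_j for j < 0 arbitrary). Then the smallest G-invariant subspace of F containing 𝟙 is all of F, i.e., 𝟙 is a cyclic vector for the operators G(m), m ∈ (1/2)ℤ. -/
/-!
Common setup (following Adamović–Jing–Misra, "On principal realization of modules for
the affine Lie algebra A₁⁽¹⁾ at the critical level").

Half-integers `(1/2)ℤ` are encoded by doubling: an integer `n : ℤ` stands for the
half-integer `n/2`.
-/

noncomputable section

/-- For `m ≥ 0`, `Φ(m)` does not raise the exterior degree. -/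
lemma Phi_bVec_mem_of_nonneg (ε c : ℂ) (W : Submodule ℂ FSpace) (k : ℕ)
    (hk : ∀ s : Finset HalfPos, s.card ≤ k → bVec s ∈ W) (t : Finset HalfPos)
    (ht : t.card ≤ k) (m : ℤ) (hm : 0 ≤ m) : Phi ε c m (bVec t) ∈ W := by
  rcases hm.lt_or_eq with h | rfl
  · rw [Phi, dif_pos h, phiAnnih, bVec, Finsupp.linearCombination_single, one_smul]
    split_ifs
    · exact W.smul_mem _ (hk _ ((Finset.card_erase_le).trans ht))
    · exact W.zero_mem
  · simpa [Phi] using W.smul_mem (ε * c) (hk t ht)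

/-- An invariant subspace containing all monomials of degree at most `k` is closed under
applying any `Φ(m)` to such monomials. -/
lemma Phi_bVec_mem (ε c : ℂ) (χ : ℤ → ℂ) (L : ℕ) (hχ0 : χ 0 = ((L : ℂ) + 1) / 2)
    (W : Submodule ℂ FSpace) (hW : GInvariant ε c 0 χ W) (k : ℕ)
    (hk : ∀ s : Finset HalfPos, s.card ≤ k → bVec s ∈ W) (t : Finset HalfPos)
    (ht : t.card ≤ k) (n : ℕ) : ∀ m : ℤ, -(n : ℤ) ≤ m → Phi ε c m (bVec t) ∈ W := by
  induction n with
  | zero =>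
    intro m hm
    exact Phi_bVec_mem_of_nonneg ε c W k hk t ht m (by simpa using hm)
  | succ n ih =>
    intro m hm
    by_cases hmn : -(n : ℤ) ≤ m
    · exact ih m hmn
    obtain rfl : m = -((n : ℤ) + 1) := by push_cast at hm; omega
    have hG := hW (-((n : ℤ) + 1)) _ (hk t ht)
    rw [Gop, bVec, Finsupp.linearCombination_single, one_smul,
      ← Finset.add_sum_erase _ _ (a := 0) (by simp), ← add_assoc, sub_zero, ← add_smul,
      hχ0] at hG
    have hsum := (Submodule.add_mem_iff_left W (W.sum_mem fun j hj => ?_)).1 hG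
    · refine (W.smul_mem_iff ?_).1 hsum
      have h : ((L + (n + 1) : ℕ) : ℂ) / 2 ≠ 0 :=
        div_ne_zero (Nat.cast_ne_zero.2 (by omega)) two_ne_zero
      convert h using 1
      push_cast
      ring
    · refine W.smul_mem _ (ih _ ?_)
      simp only [Finset.mem_erase, Finset.mem_union, Finset.mem_Icc, Finset.mem_filter] at hj
      omega

/-- An invariant subspace containing the vacuum contains every basis monomial. -/
lemma bVec_mem_of_vacuum_mem (ε c : ℂ) (χ : ℤ → ℂ) (L : ℕ) (hχ0 : χ 0 = ((L : ℂ) + 1) / 2)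
    (W : Submodule ℂ FSpace) (hW : GInvariant ε c 0 χ W) (hv : vacuum ∈ W) (k : ℕ) :
    ∀ s : Finset HalfPos, s.card ≤ k → bVec s ∈ W := by
  induction k with
  | zero =>
    intro s hs
    obtain rfl : s = ∅ := Finset.card_eq_zero.1 (Nat.le_zero.1 hs)
    exact hv
  | succ k ih =>
    intro s hs
    rcases s.eq_empty_or_nonempty with rfl | ⟨r, hr⟩
    · exact hv
    have hcard : (s.erase r).card ≤ k := by rw [Finset.card_erase_of_mem hr]; omega
    have h := Phi_bVec_mem ε c χ L hχ0 W hW k ih (s.erase r) hcard r.1.toNat (-r.1)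
      (by have := r.2; omega)
    have hr0 := r.2
    rw [Phi, dif_neg (by omega), dif_pos (by omega), phiCreate, bVec,
      Finsupp.linearCombination_single, one_smul] at h
    simp only [neg_neg, Subtype.coe_eta, Finset.notMem_erase, if_false,
      Finset.insert_erase hr] at h
    exact (W.smul_mem_iff (pow_ne_zero _ (by norm_num))).1 h

/-- from the proof of Proposition 4.4 of the paper.  If `p = 0` and
`χ₀ = ℓ + ½` with `ℓ ∈ ½ℤ`, `ℓ ≥ 0` (`L = 2ℓ ∈ ℕ`), then `𝟙` is cyclic: the smallest
`G`-invariant subspace containing `𝟙` is all of `F`. -/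
theorem vacuum_cyclic
    (ε c : ℂ) (hε : ε = 1 ∨ ε = -1) (hc : c ^ 2 = -(1 / 2))
    (χ : ℤ → ℂ) (L : ℕ) (hχ0 : χ 0 = ((L : ℂ) + 1) / 2) :
    genSub ε c 0 χ vacuum = ⊤ := by
  refine sInf_eq_top.2 fun W ⟨hW, hv⟩ => eq_top_iff.2 fun v _ => ?_
  induction v using Finsupp.induction_linear with
  | zero => exact W.zero_mem
  | add f g hf hg => exact W.add_mem (hf trivial) (hg trivial)
  | single s a =>
    have h := W.smul_mem a (bVec_mem_of_vacuum_mem ε c χ L hχ0 W hW hv s.card s le_rfl)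
    simpa [bVec] using h
end
end

section
/- Assume p = 0, χ₀ = ℓ + 1/2 with ℓ ∈ (1/2)ℤ, ℓ > 0, and assume F(χ) is not irreducible. Let P_ℓ = e_ℓ + Σ_{k=1}^{2ℓ−1} a_{−k/2} e_{ℓ−k/2} + a_{−ℓ}𝟙 be the unique vector of this form contained in every nonzero proper G-invariant subspace, and let U(χ) be the smallest G-invariant subspace of F containing P_ℓ. Then: (a) U(χ) has no G-invariant subspaces other than {0} and itself; and (b) the only G-invariant subspaces W with U(χ) ⊆ W ⊆ F are U(χ) and F (equivalently, the quotient F/U(χ) is irreducible under the induced operators). In particular U(χ) is the unique maximal proper G-invariant subspace of F. -/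
/-!
Common setup (following Adamović–Jing–Misra, "On principal realization of modules for
the affine Lie algebra A₁⁽¹⁾ at the critical level").

Half-integers `(1/2)ℤ` are encoded by doubling: an integer `n : ℤ` stands for the
half-integer `n/2`.
-/

noncomputable section

/-- `e_{n/2}` for `n > 0`, and the vacuum `𝟙` for `n = 0` (doubled index). -/
def PvecTerm (n : ℤ) : FSpace := if h : 0 < n then eVec ⟨n, h⟩ else vacuum

/-- The vector `P_ℓ = e_ℓ + Σ_{k=1}^{2ℓ-1} a_{-k/2} e_{ℓ-k/2} + a_{-ℓ} 𝟙`, for `ℓ = L/2`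
with coefficients `a : Fin L → ℂ` (`a ⟨k-1⟩` being `a_{-k/2}`, `k = 1, …, L = 2ℓ`). -/
def Pvec (L : ℕ) (a : Fin L → ℂ) : FSpace :=
  PvecTerm (L : ℤ) + ∑ k : Fin L, a k • PvecTerm ((L : ℤ) - ((k : ℕ) + 1))

theorem phiAnnih_bVec (r : HalfPos) (s : Finset HalfPos) :
    phiAnnih r (bVec s) = if r ∈ s then
      ((-(-1 : ℂ) ^ r.1) * (-1 : ℂ) ^ (s.filter fun t => t < r).card) • bVec (s.erase r)
    else 0 := by
  simp [phiAnnih, bVec]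

theorem phiCreate_bVec (r : HalfPos) (s : Finset HalfPos) :
    phiCreate r (bVec s) = if r ∈ s then 0
    else ((-1 : ℂ) ^ (s.filter fun t => t < r).card) • bVec (insert r s) := by
  simp [phiCreate, bVec]

theorem Phi_of_pos (ε c : ℂ) {m : ℤ} (h : 0 < m) : Phi ε c m = phiAnnih ⟨m, h⟩ := by
  simp [Phi, h]

theorem Phi_of_neg (ε c : ℂ) {m : ℤ} (h : 0 < m) : Phi ε c (-m) = phiCreate ⟨m, h⟩ := by
  have h1 : ¬ 0 < -m := by omega
  have h2 : -m < 0 := by omega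
  simp [Phi, h]; omega

/-- Coordinates of `Φ(r) f` in the monomial basis. -/
theorem phiAnnih_apply (r : HalfPos) (f : FSpace) (t : Finset HalfPos) :
    phiAnnih r f t = if r ∈ t then 0
      else ((-(-1 : ℂ) ^ r.1) * (-1 : ℂ) ^ (t.filter fun x => x < r).card) *
        f (insert r t) := by
  induction f using Finsupp.induction_linear with
  | zero => simp
  | add f g hf hg =>
    rw [map_add, Finsupp.add_apply, hf, hg, Finsupp.add_apply]
    split_ifs <;> ring
  | single s z =>
    have hz : (Finsupp.single s z : FSpace) = z • bVec s := by simp [bVec]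
    rw [hz, map_smul, phiAnnih_bVec]
    by_cases hs : r ∈ s
    · by_cases ht : r ∈ t
      · have : s.erase r ≠ t := by rintro rfl; simp at ht
        simp [hs, ht, bVec, this]
      · by_cases hst : s = insert r t
        · subst hst
          simp [ht, bVec, Finset.filter_insert, Finset.erase_insert ht]
          ring
        · have : s.erase r ≠ t := by
            rintro rfl; exact hst (Finset.insert_erase hs).symm
          simp [hs, ht, bVec, this, hst]
    · have : s ≠ insert r t := by rintro rfl; simp at hs
      simp [hs, bVec, this]

/-- Two operators on `F` agreeing on monomials agree. -/
theorem linearMap_ext_bVec {f g : FSpace →ₗ[ℂ] FSpace} (h : ∀ s, f (bVec s) = g (bVec s)) :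
    f = g := by
  ext1 s
  ext1
  simpa [bVec] using h s

theorem card_filter_insert (r s : HalfPos) (t : Finset HalfPos) (hr : r ∉ t) :
    ((insert r t).filter fun x => x < s).card =
      (t.filter fun x => x < s).card + if r < s then 1 else 0 := by
  rw [Finset.filter_insert]
  split_ifs
  · rw [Finset.card_insert_of_notMem (by simp [hr])]
  · simp

theorem phiAnnih_anticomm_s9 (r s : HalfPos) (v : FSpace) :
    phiAnnih r (phiAnnih s v) + phiAnnih s (phiAnnih r v) = 0 := by
  ext t
  simp only [Finsupp.add_apply, phiAnnih_apply, Finsupp.zero_apply]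
  by_cases hrs : r = s
  · subst hrs; simp
  by_cases hr : r ∈ t
  · simp [hr]
  by_cases hs : s ∈ t
  · simp [hs]
  have h1 : ¬ s ∈ insert r t := by simp [hs, Ne.symm hrs]
  have h2 : ¬ r ∈ insert s t := by simp [hr, hrs]
  simp only [hr, hs, h1, h2, if_false, card_filter_insert r s t hr, card_filter_insert s r t hs,
    Finset.insert_comm s r t]
  rcases lt_or_gt_of_ne hrs with h | h
  · simp only [h, h.not_gt, if_true, if_false, pow_add]; ring
  · simp only [h, h.not_gt, if_true, if_false, pow_add]; ring

theorem phiAnnih_phiCreate_of_ne {r s : HalfPos} (hrs : r ≠ s) (v : FSpace) :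
    phiAnnih r (phiCreate s v) + phiCreate s (phiAnnih r v) = 0 := by
  suffices phiAnnih r ∘ₗ phiCreate s + phiCreate s ∘ₗ phiAnnih r = 0 from
    LinearMap.congr_fun this v
  refine linearMap_ext_bVec fun t => ?_
  simp only [LinearMap.add_apply, LinearMap.comp_apply, LinearMap.zero_apply, phiAnnih_bVec,
    phiCreate_bVec]
  by_cases hs : s ∈ t
  · by_cases hr : r ∈ t
    · simp [hs, hr, phiCreate_bVec, Ne.symm hrs]
    · simp [hs, hr]
  · by_cases hr : r ∈ t
    · obtain ⟨t, hr', rfl⟩ : ∃ t', r ∉ t' ∧ insert r t' = t :=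
        ⟨t.erase r, by simp, Finset.insert_erase hr⟩
      have hs' : s ∉ t := fun h => hs (by simp [h])
      have h2 : r ∉ insert s t := by simp [hr', hrs]
      have h3 : insert s (insert r t) = insert r (insert s t) := Finset.insert_comm ..
      simp only [hs, hs', if_false, Finset.mem_insert_self, if_true, map_smul, phiCreate_bVec,
        phiAnnih_bVec, h3, Finset.erase_insert hr', Finset.erase_insert h2,
        card_filter_insert r s t hr', card_filter_insert r r _ h2,
        card_filter_insert s r t hs', card_filter_insert r r t hr', smul_smul, ← add_smul]
      convert zero_smul ℂ _
      rcases lt_or_gt_of_ne hrs with h | h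
      · simp only [h, h.not_gt, lt_irrefl, if_true, if_false, pow_add]; ring
      · simp only [h, h.not_gt, lt_irrefl, if_true, if_false, pow_add]; ring
    · simp [hs, hr, phiAnnih_bVec, hrs]

theorem phiAnnih_phiCreate_self (r : HalfPos) (v : FSpace) :
    phiAnnih r (phiCreate r v) + phiCreate r (phiAnnih r v) = (-(-1 : ℂ) ^ r.1) • v := by
  suffices phiAnnih r ∘ₗ phiCreate r + phiCreate r ∘ₗ phiAnnih r =
    (-(-1 : ℂ) ^ r.1) • LinearMap.id from LinearMap.congr_fun this v
  refine linearMap_ext_bVec fun t => ?_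
  have hsq (n : ℕ) : (-1 : ℂ) ^ n * (-1 : ℂ) ^ n = 1 := by
    rw [← mul_pow]; simp
  simp only [LinearMap.add_apply, LinearMap.comp_apply, LinearMap.smul_apply, LinearMap.id_apply,
    phiAnnih_bVec, phiCreate_bVec]
  by_cases hr : r ∈ t
  · obtain ⟨t, hr', rfl⟩ : ∃ t', r ∉ t' ∧ insert r t' = t :=
      ⟨t.erase r, by simp, Finset.insert_erase hr⟩
    simp only [Finset.mem_insert_self, if_true, map_zero, zero_add, map_smul, phiCreate_bVec,
      Finset.erase_insert hr', hr', if_false, card_filter_insert r r t hr', lt_irrefl, add_zero,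
      smul_smul, mul_assoc, hsq, mul_one]
  · simp only [hr, if_false, map_zero, add_zero, map_smul, phiAnnih_bVec, Finset.mem_insert_self,
      if_true, Finset.erase_insert hr, card_filter_insert r r t hr, lt_irrefl, smul_smul]
    rw [mul_left_comm, hsq, mul_one]

/-- Only multiples of the vacuum are annihilated by every `Φ(r)`, `r > 0`. -/
theorem eq_smul_vacuum_of_phiAnnih {v : FSpace} (h : ∀ r, phiAnnih r v = 0) :
    v = v ∅ • vacuum := by
  ext t
  rcases t.eq_empty_or_nonempty with rfl | ⟨r, hr⟩
  · simp [vacuum, bVec]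
  · have h1 := DFunLike.congr_fun (h r) (t.erase r)
    rw [phiAnnih_apply] at h1
    have hne : (∅ : Finset HalfPos) ≠ t := by rintro rfl; simp at hr
    have h2 : v t = 0 := by
      simpa [Finset.insert_erase hr, zpow_ne_zero] using h1
    simp [vacuum, bVec, hne, h2]

/-- On each vector the sum defining `G(m)` may be truncated uniformly in `m`. -/
theorem exists_Gop_eq_sum (ε c : ℂ) (χ : ℤ → ℂ) (v : FSpace) :
    ∃ M : ℤ, 0 ≤ M ∧ ∀ N ≥ M, (∀ n > N, Phi ε c n v = 0) ∧
      ∀ m, Gop ε c 0 χ m v = (-((m : ℂ) + 1) / 2) • Phi ε c m v +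
        ∑ n ∈ Finset.Icc m N, χ (m - n) • Phi ε c n v := by
  induction v using Finsupp.induction_linear with
  | zero => exact ⟨0, le_rfl, fun N _ => by simp⟩
  | add f g hf hg =>
    obtain ⟨M, hM, hf⟩ := hf
    obtain ⟨M', hM', hg⟩ := hg
    refine ⟨max M M', le_max_of_le_left hM, fun N hN => ?_⟩
    obtain ⟨h1, h2⟩ := hf N (le_trans (le_max_left _ _) hN)
    obtain ⟨h3, h4⟩ := hg N (le_trans (le_max_right _ _) hN)
    refine ⟨fun n hn => by rw [map_add, h1 n hn, h3 n hn, add_zero], fun m => ?_⟩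
    simp only [map_add, h2, h4, smul_add, Finset.sum_add_distrib]
    abel
  | single s z =>
    have hz : (Finsupp.single s z : FSpace) = z • bVec s := by simp [bVec]
    obtain ⟨B, hB⟩ : ∃ B : ℤ, ∀ t ∈ s, t.1 ≤ B := by
      obtain ⟨B, hB⟩ := (s.image Subtype.val).bddAbove
      exact ⟨B, fun t ht => hB (by simpa using ⟨t.2, ht⟩)⟩
    have hvan : ∀ n : ℤ, 0 < n → (∀ t ∈ s, t.1 ≠ n) → Phi ε c n (bVec s) = 0 := by
      intro n hn h
      rw [Phi_of_pos ε c hn, phiAnnih_bVec, if_neg fun hmem => h _ hmem rfl]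
    refine ⟨max B 0, le_max_right _ _, fun N hN => ⟨fun n hn => ?_, fun m => ?_⟩⟩
    · rw [hz, map_smul, hvan n (by omega) fun t ht => by have := hB t ht; omega, smul_zero]
    · have hG : Gop ε c 0 χ m (bVec s) = (-((m : ℂ) + 1) / 2) • Phi ε c m (bVec s) +
          ∑ n ∈ Finset.Icc m N, χ (m - n) • Phi ε c n (bVec s) := by
        rw [Gop]
        conv_lhs => rw [bVec, Finsupp.linearCombination_single, one_smul]
        congr 1
        have hbij : ∑ n ∈ Finset.Icc m N, χ (m - n) • Phi ε c n (bVec s) =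
            ∑ j ∈ Finset.Icc (m - N) 0, χ j • Phi ε c (m - j) (bVec s) := by
          refine Finset.sum_bij' (fun n _ => m - n) (fun j _ => m - j) ?_ ?_ ?_ ?_ ?_
          all_goals intro x hx
          all_goals simp only [Finset.mem_Icc] at hx ⊢
          all_goals first | omega | simp
        rw [hbij]
        refine Finset.sum_subset (fun j hj => ?_) fun j hj hj' => ?_
        · simp only [Finset.mem_union, Finset.mem_Icc, Finset.mem_filter, Finset.mem_image] at hj ⊢
          rcases hj with hj | ⟨⟨t, ht, rfl⟩, hj⟩
          · omega
          · have := hB t ht; omega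
        · simp only [Finset.mem_union, Finset.mem_Icc, Finset.mem_filter, Finset.mem_image,
            not_or, not_and] at hj hj'
          rw [hvan (m - j) (by by_contra h; exact hj'.1 (by omega) hj.2) fun t ht h =>
            hj'.2 ⟨t, ht, by omega⟩ hj.2, smul_zero]
      rw [hz, map_smul, hG, map_smul, smul_add, smul_comm, Finset.smul_sum]
      congr 1
      exact Finset.sum_congr rfl fun n _ => by rw [map_smul, smul_comm]

section Truncation

variable {ε c : ℂ} {χ : ℤ → ℂ} {L : ℕ}

theorem exists_Gop_eq_leading (hχ0 : χ 0 = ((L : ℂ) + 1) / 2) (v : FSpace) :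
    ∃ M : ℤ, ∀ N ≥ M, (∀ n > N, Phi ε c n v = 0) ∧
      ∀ m ≤ N, Gop ε c 0 χ m v = (((L : ℂ) - m) / 2) • Phi ε c m v +
        ∑ n ∈ Finset.Icc (m + 1) N, χ (m - n) • Phi ε c n v := by
  obtain ⟨M, -, h⟩ := exists_Gop_eq_sum ε c χ v
  refine ⟨M, fun N hN => ⟨(h N hN).1, fun m hm => ?_⟩⟩
  have hI : Finset.Icc m N = insert m (Finset.Icc (m + 1) N) := by
    ext x; simp only [Finset.mem_insert, Finset.mem_Icc]; omega
  rw [(h N hN).2 m, hI, Finset.sum_insert (by simp), sub_self, hχ0, ← add_assoc, ← add_smul]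
  congr 2
  ring

theorem GInvariant.Phi_mem_of_lt (hχ0 : χ 0 = ((L : ℂ) + 1) / 2) {W : Submodule ℂ FSpace}
    (hW : GInvariant ε c 0 χ W) {v : FSpace} (hv : v ∈ W) {m : ℤ} (hm : (L : ℤ) < m) :
    Phi ε c m v ∈ W := by
  obtain ⟨N, hN⟩ := exists_Gop_eq_leading (ε := ε) (c := c) hχ0 v
  obtain ⟨hbig, hG⟩ := hN N le_rfl
  induction hk : (N + 1 - m).toNat using Nat.strong_induction_on generalizing m with
  | _ k ih =>
    by_cases hmN : N < m
    · rw [hbig m hmN]; exact W.zero_mem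
    have hsum : ∑ n ∈ Finset.Icc (m + 1) N, χ (m - n) • Phi ε c n v ∈ W := by
      refine W.sum_mem fun n hn => W.smul_mem _ ?_
      rw [Finset.mem_Icc] at hn
      exact ih (N + 1 - n).toNat (by omega) (by omega) rfl
    have h1 := hW m v hv
    rw [hG m (by omega)] at h1
    have h2 := (W.add_mem_iff_left hsum).1 h1
    refine (W.smul_mem_iff ?_).1 h2
    have : (L : ℂ) - m ≠ 0 := by
      rw [sub_ne_zero]; intro h
      have : (L : ℤ) = m := by exact_mod_cast h
      omega
    simpa using this

/-- Every `G`-invariant subspace is stable under suitable operators `Φ(m) + b_m Φ(ℓ)`. -/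
theorem exists_coeff_Phi_add_mem (ε c : ℂ) (hχ0 : χ 0 = ((L : ℂ) + 1) / 2) (m : ℤ) :
    ∃ b : ℂ, ((L : ℤ) < m → b = 0) ∧ ∀ W, GInvariant ε c 0 χ W → ∀ v ∈ W,
      Phi ε c m v + b • Phi ε c L v ∈ W := by
  induction hk : (L - m).toNat using Nat.strong_induction_on generalizing m with
  | _ k ih =>
    rcases lt_trichotomy (L : ℤ) m with hm | hm | hm
    · exact ⟨0, fun _ => rfl, fun W hW v hv => by simpa using hW.Phi_mem_of_lt hχ0 hv hm⟩
    · exact ⟨-1, fun h => by omega, fun W hW v hv => by simp [← hm]⟩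
    have hex : ∀ n : ℤ, ∃ b : ℂ, m < n → ((L : ℤ) < n → b = 0) ∧ ∀ W, GInvariant ε c 0 χ W →
        ∀ v ∈ W, Phi ε c n v + b • Phi ε c L v ∈ W := by
      intro n
      by_cases hn : m < n
      · obtain ⟨b, hb⟩ := ih (L - n).toNat (by omega) n rfl
        exact ⟨b, fun _ => hb⟩
      · exact ⟨0, fun h => absurd h hn⟩
    choose b hb using hex
    have hne : ((L : ℂ) - m) / 2 ≠ 0 := by
      have : (L : ℂ) - m ≠ 0 := by
        rw [sub_ne_zero]; intro h
        have : (L : ℤ) = m := by exact_mod_cast h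
        omega
      simpa using this
    set S : ℂ := ∑ n ∈ Finset.Icc (m + 1) L, χ (m - n) * b n with hS
    refine ⟨(((L : ℂ) - m) / 2)⁻¹ * -S, fun h => by omega, fun W hW v hv => ?_⟩
    obtain ⟨M, hM⟩ := exists_Gop_eq_leading (ε := ε) (c := c) hχ0 v
    obtain ⟨-, hG⟩ := hM (max M L) (le_max_left _ _)
    have hS' : S = ∑ n ∈ Finset.Icc (m + 1) (max M L), χ (m - n) * b n := by
      refine Finset.sum_subset (Finset.Icc_subset_Icc_right (le_max_right _ _)) fun n hn hn' => ?_
      simp only [Finset.mem_Icc] at hn hn'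
      rw [(hb n (by omega)).1 (by omega), mul_zero]
    have hsum : ∑ n ∈ Finset.Icc (m + 1) (max M L),
        χ (m - n) • (Phi ε c n v + b n • Phi ε c L v) ∈ W := by
      refine W.sum_mem fun n hn => W.smul_mem _ ?_
      rw [Finset.mem_Icc] at hn
      exact (hb n (by omega)).2 W hW v hv
    have h1 := W.sub_mem (hW m v hv) hsum
    rw [hG m (by omega)] at h1
    simp only [smul_add, smul_smul, Finset.sum_add_distrib, ← Finset.sum_smul, ← hS'] at h1
    rw [← W.smul_mem_iff hne, smul_add, smul_smul, mul_inv_cancel_left₀ hne]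
    convert h1 using 1
    module

end Truncation

/-- A subspace stable under a pair of operator families satisfying the Clifford relations, the
annihilators being locally finite, is generated by the vectors in it killed by all annihilators. -/
theorem le_of_singular_le {ι V : Type*} [AddCommGroup V] [Module ℂ V]
    {A C : ι → V →ₗ[ℂ] V} {κ : ι → ℂ} (hκ : ∀ i, κ i ≠ 0)
    (hAA : ∀ i j v, A i (A j v) + A j (A i v) = 0)
    (hAC : ∀ i j v, i ≠ j → A i (C j v) + C j (A i v) = 0)
    (hACs : ∀ i v, A i (C i v) + C i (A i v) = κ i • v)
    (hfin : ∀ v, {i | A i v ≠ 0}.Finite)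
    {W M : Submodule ℂ V} (hWA : ∀ i, ∀ v ∈ W, A i v ∈ W) (hWC : ∀ i, ∀ v ∈ W, C i v ∈ W)
    (hMC : ∀ i, ∀ v ∈ M, C i v ∈ M)
    (hsing : ∀ v ∈ W, (∀ i, A i v = 0) → v ∈ M) : W ≤ M := by
  classical
  suffices ∀ S : Finset ι, ∀ v ∈ W, (∀ i ∉ S, A i v = 0) → v ∈ M by
    intro v hv
    exact this (hfin v).toFinset v hv fun i hi => by simpa using hi
  intro S
  induction S using Finset.induction_on with
  | empty => exact fun v hv h => hsing v hv fun i => h i (by simp)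
  | insert j S hj ih =>
    intro v hv h
    have hAjj (w : V) : A j (A j w) = 0 := by
      have := hAA j j w
      rwa [← two_smul ℂ, smul_eq_zero_iff_right two_ne_zero] at this
    have hx : A j v ∈ M := by
      refine ih _ (hWA j v hv) fun i hi => ?_
      by_cases hij : i = j
      · rw [hij, hAjj]
      · have := hAA i j v
        rwa [h i (by simp [hij, hi]), map_zero, add_zero] at this
    have hy : A j (C j v) ∈ M := by
      refine ih _ (hWA j _ (hWC j v hv)) fun i hi => ?_
      by_cases hij : i = j
      · rw [hij, hAjj]
      · have h1 := hAC i j v hij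
        rw [h i (by simp [hij, hi]), map_zero, add_zero] at h1
        have := hAA i j (C j v)
        rwa [h1, map_zero, add_zero] at this
    have := M.add_mem hy (hMC j _ hx)
    rwa [hACs, M.smul_mem_iff (hκ j)] at this

theorem phiAnnih_vacuum (r : HalfPos) : phiAnnih r vacuum = 0 := by
  simp [vacuum, phiAnnih_bVec]

theorem phiAnnih_PvecTerm (r : HalfPos) (n : ℤ) :
    phiAnnih r (PvecTerm n) = if n = r.1 then (-(-1 : ℂ) ^ r.1) • vacuum else 0 := by
  by_cases h : 0 < n
  · by_cases hn : n = r.1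
    · subst hn
      simp [PvecTerm, r.2, eVec, phiAnnih_bVec, vacuum, Finset.filter_singleton]
    · have : r ≠ ⟨n, h⟩ := by rintro rfl; exact hn rfl
      simp [PvecTerm, h, eVec, phiAnnih_bVec, hn, this]
  · have hn : n ≠ r.1 := by have := r.2; omega
    simp [PvecTerm, h, phiAnnih_vacuum, hn]

theorem phiAnnih_Pvec_self {L : ℕ} (hL : (0 : ℤ) < L) (a : Fin L → ℂ) :
    phiAnnih ⟨L, hL⟩ (Pvec L a) = (-(-1 : ℂ) ^ L) • vacuum := by
  rw [Pvec, map_add, map_sum, phiAnnih_PvecTerm, if_pos rfl, Finset.sum_eq_zero, add_zero]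
  · simp
  · intro k _
    rw [map_smul, phiAnnih_PvecTerm, if_neg (by simp only; omega), smul_zero]

theorem phiAnnih_Pvec_of_lt {L : ℕ} (a : Fin L → ℂ) (r : HalfPos) (k : Fin L)
    (hk : r.1 = L - ((k : ℕ) + 1)) :
    phiAnnih r (Pvec L a) = (-(-1 : ℂ) ^ r.1 * a k) • vacuum := by
  rw [Pvec, map_add, map_sum, phiAnnih_PvecTerm, if_neg (by omega), zero_add,
    Finset.sum_eq_single k]
  · rw [map_smul, phiAnnih_PvecTerm, if_pos hk.symm, smul_smul, mul_comm]
  · intro j _ hj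
    have : (j : ℕ) ≠ k := fun h => hj (Fin.ext h)
    rw [map_smul, phiAnnih_PvecTerm, if_neg (by omega), smul_zero]
  · simp

theorem phiAnnih_Pvec_of_gt {L : ℕ} (a : Fin L → ℂ) (r : HalfPos) (hr : (L : ℤ) < r.1) :
    phiAnnih r (Pvec L a) = 0 := by
  rw [Pvec, map_add, map_sum, phiAnnih_PvecTerm, if_neg (by omega), zero_add]
  refine Finset.sum_eq_zero fun k _ => ?_
  rw [map_smul, phiAnnih_PvecTerm, if_neg (by omega), smul_zero]

/-- The vectors killed by all `Φ(r) + b_r Φ(ℓ)`, `r ≠ ℓ`, lie in a plane spanned by the vacuum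
and a vector of the shape `P_ℓ`. -/
theorem exists_Pvec_singular {L : ℕ} (hL : (0 : ℤ) < L) (b : ℤ → ℂ)
    (hb : ∀ m : ℤ, (L : ℤ) < m → b m = 0) :
    ∃ a : Fin L → ℂ, ∀ v : FSpace,
      (∀ r : HalfPos, r.1 ≠ L → phiAnnih r v + b r.1 • phiAnnih ⟨L, hL⟩ v = 0) →
      ∃ α γ : ℂ, v = α • vacuum + γ • Pvec L a := by
  refine ⟨fun k => -(-1 : ℂ) ^ L * (-1 : ℂ) ^ ((L : ℤ) - ((k : ℕ) + 1)) *
    b (L - ((k : ℕ) + 1)), fun v hv => ?_⟩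
  set l : HalfPos := ⟨L, hL⟩ with hl
  have hll (w : FSpace) : phiAnnih l (phiAnnih l w) = 0 := by
    have := phiAnnih_anticomm_s9 l l w
    rwa [← two_smul ℂ, smul_eq_zero_iff_right two_ne_zero] at this
  have hκ : phiAnnih l v = phiAnnih l v ∅ • vacuum := by
    refine eq_smul_vacuum_of_phiAnnih fun r => ?_
    by_cases hr : r.1 = L
    · rw [show r = l from Subtype.ext hr, hll]
    · have h1 := phiAnnih_anticomm_s9 r l v
      rw [eq_neg_of_add_eq_zero_left (hv r hr), map_neg, map_smul, hll] at h1
      simpa using h1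
  set κ := phiAnnih l v ∅
  have hsq : (-1 : ℂ) ^ L * (-1 : ℂ) ^ L = 1 := by rw [← mul_pow]; simp
  set a : Fin L → ℂ := fun k => -(-1 : ℂ) ^ L * (-1 : ℂ) ^ ((L : ℤ) - ((k : ℕ) + 1)) *
    b (L - ((k : ℕ) + 1)) with ha
  have hw : ∀ r, phiAnnih r (v - (-(-1 : ℂ) ^ L * κ) • Pvec L a) = 0 := by
    intro r
    rw [map_sub, map_smul]
    rcases lt_trichotomy (L : ℤ) r.1 with hr | hr | hr
    · have h1 := hv r (by omega)
      rw [hb _ hr, zero_smul, add_zero] at h1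
      rw [h1, phiAnnih_Pvec_of_gt a r hr, smul_zero, sub_zero]
    · rw [show r = l from Subtype.ext hr.symm, hκ, phiAnnih_Pvec_self, smul_smul, ← sub_smul]
      convert zero_smul ℂ _
      linear_combination -κ * hsq
    · have hr0 := r.2
      obtain ⟨k, hk⟩ : ∃ k : Fin L, r.1 = L - ((k : ℕ) + 1) :=
        ⟨⟨(L - r.1 - 1).toNat, by omega⟩, by simp only; omega⟩
      rw [eq_neg_of_add_eq_zero_left (hv r (by omega)), hκ, phiAnnih_Pvec_of_lt a r k hk,
        smul_smul, smul_smul, ← neg_smul, ← sub_smul]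
      convert zero_smul ℂ _
      have hsr : (-1 : ℂ) ^ r.1 * (-1 : ℂ) ^ r.1 = 1 := by rw [← mul_zpow]; simp
      simp only [ha, ← hk]
      linear_combination κ * b r.1 * (-1 : ℂ) ^ r.1 * (-1 : ℂ) ^ r.1 * hsq + κ * b r.1 * hsr
  refine ⟨(v - (-(-1 : ℂ) ^ L * κ) • Pvec L a) ∅, -(-1 : ℂ) ^ L * κ, ?_⟩
  rw [← eq_smul_vacuum_of_phiAnnih hw, sub_add_cancel]

/-- Inclusion between `G`-invariant subspaces can be tested on vectors of the plane spanned by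
the vacuum and a suitable vector of the shape `P_ℓ`. -/
theorem exists_Pvec_forall_le (ε c : ℂ) {χ : ℤ → ℂ} {L : ℕ} (hL : 0 < L)
    (hχ0 : χ 0 = ((L : ℂ) + 1) / 2) :
    ∃ a : Fin L → ℂ, ∀ W M : Submodule ℂ FSpace, GInvariant ε c 0 χ W → GInvariant ε c 0 χ M →
      (∀ α γ : ℂ, α • vacuum + γ • Pvec L a ∈ W → α • vacuum + γ • Pvec L a ∈ M) → W ≤ M := by
  have hL' : (0 : ℤ) < L := by exact_mod_cast hL
  choose b hb using exists_coeff_Phi_add_mem (L := L) ε c hχ0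
  obtain ⟨a, ha⟩ := exists_Pvec_singular hL' b fun m => (hb m).1
  refine ⟨a, fun W M hW hM h => ?_⟩
  set l : HalfPos := ⟨L, hL'⟩ with hl
  let A : {r : HalfPos // r.1 ≠ L} → FSpace →ₗ[ℂ] FSpace := fun r =>
    phiAnnih r.1 + b r.1.1 • phiAnnih l
  let C : {r : HalfPos // r.1 ≠ L} → FSpace →ₗ[ℂ] FSpace := fun r =>
    phiCreate r.1 + b (-r.1.1) • phiAnnih l
  have hΦL : Phi ε c L = phiAnnih l := Phi_of_pos ε c hL'
  have hA {U : Submodule ℂ FSpace} (hU : GInvariant ε c 0 χ U) (r) (v : FSpace) (hv : v ∈ U) :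
      A r v ∈ U := by
    have := (hb r.1.1).2 U hU v hv
    rwa [hΦL, Phi_of_pos ε c r.1.2] at this
  have hC {U : Submodule ℂ FSpace} (hU : GInvariant ε c 0 χ U) (r) (v : FSpace) (hv : v ∈ U) :
      C r v ∈ U := by
    have := (hb (-r.1.1)).2 U hU v hv
    rwa [hΦL, Phi_of_neg ε c r.1.2] at this
  have hne (r : {r : HalfPos // r.1 ≠ L}) : l ≠ r.1 := fun h => r.2 (by rw [← h])
  have hll (w : FSpace) : phiAnnih l (phiAnnih l w) = 0 := by
    have := phiAnnih_anticomm_s9 l l w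
    rwa [← two_smul ℂ, smul_eq_zero_iff_right two_ne_zero] at this
  have hAC (i j : {r : HalfPos // r.1 ≠ L}) (v : FSpace) : A i (C j v) + C j (A i v) =
      phiAnnih i.1 (phiCreate j.1 v) + phiCreate j.1 (phiAnnih i.1 v) := by
    have h1 := phiAnnih_phiCreate_of_ne (hne j) v
    have h2 := phiAnnih_anticomm_s9 i.1 l v
    simp only [A, C, LinearMap.add_apply, LinearMap.smul_apply, map_add, map_smul, hll, smul_zero]
    rw [eq_neg_of_add_eq_zero_left h1, eq_neg_of_add_eq_zero_left h2]
    module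
  refine le_of_singular_le (A := A) (C := C) (κ := fun i => -(-1 : ℂ) ^ i.1.1)
    (fun i => by simp [zpow_ne_zero]) (fun i j v => ?_) (fun i j v hij => ?_)
    (fun i v => ?_) (fun v => ?_) (hA hW) (hC hW) (hC hM) (fun v hv hs => ?_)
  · have h1 := phiAnnih_anticomm_s9 i.1 j.1 v
    have h2 := phiAnnih_anticomm_s9 i.1 l v
    have h3 := phiAnnih_anticomm_s9 j.1 l v
    simp only [A, LinearMap.add_apply, LinearMap.smul_apply, map_add, map_smul, hll, smul_zero]
    rw [eq_neg_of_add_eq_zero_left h1, eq_neg_of_add_eq_zero_left h2,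
      eq_neg_of_add_eq_zero_left h3]
    module
  · rw [hAC, phiAnnih_phiCreate_of_ne fun h => hij (Subtype.ext h)]
  · rw [hAC, phiAnnih_phiCreate_self]
  · obtain ⟨N, -, hN⟩ := exists_Gop_eq_sum ε c χ v
    obtain ⟨hN, -⟩ := hN N le_rfl
    have hinj : Function.Injective fun i : {r : HalfPos // r.1 ≠ L} => i.1.1 :=
      Subtype.val_injective.comp Subtype.val_injective
    refine ((Set.finite_Icc 0 (max N L)).preimage hinj.injOn).subset fun i hi => ?_
    refine ⟨i.1.2.le, ?_⟩
    by_contra! hlt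
    refine hi ?_
    have h1 := hN i.1.1 (lt_of_le_of_lt (le_max_left _ _) hlt)
    rw [Phi_of_pos ε c i.1.2] at h1
    change phiAnnih i.1 v + b i.1.1 • phiAnnih l v = 0
    rw [h1, (hb i.1.1).1 (lt_of_le_of_lt (le_max_right _ _) hlt), zero_smul, add_zero]
  · obtain ⟨α, γ, rfl⟩ := ha v fun r hr => hs ⟨r, hr⟩
    exact h α γ hv

theorem genSub_GInvariant (ε c : ℂ) (p : ℤ) (χ : ℤ → ℂ) (v : FSpace) :
    GInvariant ε c p χ (genSub ε c p χ v) := by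
  intro m w hw
  rw [genSub, Submodule.mem_sInf] at hw ⊢
  exact fun U hU => hU.1 m w (hw U hU)

theorem mem_genSub (ε c : ℂ) (p : ℤ) (χ : ℤ → ℂ) (v : FSpace) : v ∈ genSub ε c p χ v := by
  rw [genSub, Submodule.mem_sInf]
  exact fun U hU => hU.2

theorem genSub_le {ε c : ℂ} {p : ℤ} {χ : ℤ → ℂ} {v : FSpace} {W : Submodule ℂ FSpace}
    (hW : GInvariant ε c p χ W) (hv : v ∈ W) : genSub ε c p χ v ≤ W :=
  sInf_le ⟨hW, hv⟩

theorem exists_Pvec_eq_add_smul_vacuum {L : ℕ} (hL : 0 < L) (a : Fin L → ℂ) (z : ℂ) :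
    ∃ a' : Fin L → ℂ, (a' = a → z = 0) ∧ Pvec L a' = Pvec L a + z • vacuum := by
  set k : Fin L := ⟨L - 1, by omega⟩ with hk
  refine ⟨a + Pi.single k z, fun h => ?_, ?_⟩
  · simpa using congrFun h k
  · have h0 : PvecTerm ((L : ℤ) - ((k : ℕ) + 1)) = vacuum := by
      rw [PvecTerm, dif_neg (by simp only [hk]; omega)]
    have h1 : ∑ j : Fin L, (Pi.single k z : Fin L → ℂ) j • PvecTerm ((L : ℤ) - ((j : ℕ) + 1)) =
        z • vacuum := by
      rw [Finset.sum_eq_single k, Pi.single_eq_same, h0]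
      · intro j _ hj
        rw [Pi.single_eq_of_ne hj, zero_smul]
      · simp
    simp only [Pvec, Pi.add_apply, add_smul, Finset.sum_add_distrib, h1, add_assoc]

/-- Proposition 4.4 of the paper, continued.  For `p = 0`,
`χ₀ = ℓ + ½`, `ℓ > 0` (`L = 2ℓ`), if `F(χ)` is not irreducible and `P_ℓ` is the
distinguished vector, then `U(χ)`, the smallest `G`-invariant subspace containing
`P_ℓ`, (a) has no `G`-invariant subspaces besides `{0}` and itself, and (b) the only
`G`-invariant subspaces between `U(χ)` and `F` are `U(χ)` and `F` (so `F/U(χ)` is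
irreducible); in particular `U(χ)` is the unique maximal proper `G`-invariant
subspace. -/
theorem Uchi_irreducible_and_coirreducible
    (ε c : ℂ) (hε : ε = 1 ∨ ε = -1) (hc : c ^ 2 = -(1 / 2))
    (χ : ℤ → ℂ) (L : ℕ) (hL : 0 < L) (hχ0 : χ 0 = ((L : ℂ) + 1) / 2)
    (hred : ¬ FIrreducible ε c 0 χ)
    (a : Fin L → ℂ)
    (ha : ∀ U : Submodule ℂ FSpace, GInvariant ε c 0 χ U → U ≠ ⊥ → U ≠ ⊤ →
      Pvec L a ∈ U ∧ ∀ a' : Fin L → ℂ, Pvec L a' ∈ U → a' = a) :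
    (∀ W ≤ genSub ε c 0 χ (Pvec L a), GInvariant ε c 0 χ W →
      W = ⊥ ∨ W = genSub ε c 0 χ (Pvec L a)) ∧
    (∀ W : Submodule ℂ FSpace, GInvariant ε c 0 χ W →
      genSub ε c 0 χ (Pvec L a) ≤ W → W = genSub ε c 0 χ (Pvec L a) ∨ W = ⊤) := by
  have hvac : ∀ U : Submodule ℂ FSpace, GInvariant ε c 0 χ U → U ≠ ⊥ → U ≠ ⊤ →
      ∀ z : ℂ, z • vacuum ∈ U → z = 0 := by
    intro U hU hb ht z hz
    obtain ⟨hP, huniq⟩ := ha U hU hb ht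
    obtain ⟨a', h0, h1⟩ := exists_Pvec_eq_add_smul_vacuum hL a z
    exact h0 (huniq a' (h1 ▸ U.add_mem hP hz))
  obtain ⟨U₀, hU₀, hU₀b, hU₀t⟩ : ∃ U, GInvariant ε c 0 χ U ∧ U ≠ ⊥ ∧ U ≠ ⊤ := by
    simpa [FIrreducible] using hred
  refine ⟨fun W hWU hW => or_iff_not_imp_left.2 fun hWb => ?_,
    fun W hW hUW => or_iff_not_imp_right.2 fun hWt => ?_⟩
  · by_cases hWt : W = ⊤
    · exact le_antisymm hWU (hWt ▸ le_top)
    · exact le_antisymm hWU (genSub_le hW (ha W hW hWb hWt).1)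
  obtain ⟨a₀, ha₀⟩ := exists_Pvec_forall_le ε c hL hχ0
  have hbot : GInvariant ε c 0 χ ⊥ := by
    intro m v hv
    rw [Submodule.mem_bot] at hv ⊢
    rw [hv, map_zero]
  -- The distinguished vector differs from the singular one by a multiple of the vacuum.
  obtain ⟨z, hz⟩ : ∃ z : ℂ, Pvec L a = Pvec L a₀ + z • vacuum := by
    obtain ⟨α, γ, hmem, hne⟩ : ∃ α γ : ℂ, α • vacuum + γ • Pvec L a₀ ∈ U₀ ∧
        α • vacuum + γ • Pvec L a₀ ≠ 0 := by
      by_contra! h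
      exact hU₀b (le_bot_iff.1 (ha₀ U₀ ⊥ hU₀ hbot fun α γ hm => by simp [h α γ hm]))
    have hγ : γ ≠ 0 := by
      rintro rfl
      rw [zero_smul, add_zero] at hmem hne
      exact hne (by rw [hvac U₀ hU₀ hU₀b hU₀t α hmem, zero_smul])
    obtain ⟨a', -, h1⟩ := exists_Pvec_eq_add_smul_vacuum hL a₀ (γ⁻¹ * α)
    refine ⟨γ⁻¹ * α, ?_⟩
    rw [← h1, (ha U₀ hU₀ hU₀b hU₀t).2 a' ?_]
    rw [h1, ← U₀.smul_mem_iff hγ, smul_add, smul_smul, mul_inv_cancel_left₀ hγ, add_comm]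
    exact hmem
  have hPW : Pvec L a ∈ W := hUW (mem_genSub ε c 0 χ (Pvec L a))
  have hWb : W ≠ ⊥ := by
    rintro rfl
    rw [Submodule.mem_bot] at hPW
    exact hU₀b (le_bot_iff.1 (ha₀ U₀ ⊥ hU₀ hbot fun α γ hm => by
      have hα : α • vacuum + γ • Pvec L a₀ = (α - γ * z) • vacuum := by
        rw [eq_sub_of_add_eq hz.symm, hPW]; module
      rw [hα] at hm ⊢
      simp [hvac U₀ hU₀ hU₀b hU₀t _ hm]))
  refine le_antisymm (ha₀ W _ hW (genSub_GInvariant ε c 0 χ _) fun α γ hm => ?_) hUW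
  have hα : α • vacuum + γ • Pvec L a₀ = (α - γ * z) • vacuum + γ • Pvec L a := by
    rw [hz]; module
  rw [hα] at hm ⊢
  rw [hvac W hW hWb hWt _ ((W.add_mem_iff_left (W.smul_mem _ hPW)).1 hm), zero_smul, zero_add]
  exact Submodule.smul_mem _ _ (mem_genSub ε c 0 χ (Pvec L a))
end
end
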